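/- arXiv:1803.09289 — 2 statements merged into one kernel-verified Lean document; each statement's English description precedes it below -/
import Mathlib

section
/- Let f be a minmax monotone cost function on a finite tree T_in, let 𝒯 ≥ 0 be a threshold, let T = (V,E) be a working subtree of T_in with sink set S ⊆ V. Suppose u,v ∈ V with (u,v) ∈ E are such that f(V_{-v}(u) ∪ {v}, v) > 𝒯 and S ∩ V_{-v}(u) = ∅. Then there exist vertices u', v' ∈ V_{-v}(u) ∪ {v} such that the ordered pair (u',v') satisfies the peaking criterion. -/
open SimpleGraph Set
open scoped ENNReal

variable {V : Type*}

/-- The vertex set of the connected component of the subgraph of `G` induced on `A`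
containing the vertex `u` (empty if `u ∉ A`). -/
def reachSet (G : SimpleGraph V) (A : Set V) (u : V) : Set V :=
  {y | ∃ (hu : u ∈ A) (hy : y ∈ A), (G.induce A).Reachable ⟨u, hu⟩ ⟨y, hy⟩}

/-- `U` is a subtree: the induced subgraph on `U` is connected. -/
def IsSubtree (G : SimpleGraph V) (U : Set V) : Prop :=
  (G.induce U).Connected

/-- A minmax monotone cost function on the tree `G`:
`f {s} s = 0`; `f U s = ∞` if `U` is not a subtree or `s ∉ U`; set monotonicity;
path monotonicity; and max tree composition (the slices of `U` defined by `s` being the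
connected components of `U \ {s}`). -/
structure IsMinmaxMonotone (G : SimpleGraph V) (f : Set V → V → ℝ≥0∞) : Prop where
  singleton_eq_zero : ∀ s : V, f {s} s = 0
  eq_top_of_not_subtree : ∀ (U : Set V) (s : V), ¬ IsSubtree G U → f U s = ⊤
  eq_top_of_not_mem : ∀ (U : Set V) (s : V), s ∉ U → f U s = ⊤
  set_mono : ∀ (U₁ U₂ : Set V) (s : V), IsSubtree G U₁ → IsSubtree G U₂ →
    s ∈ U₁ → U₁ ⊆ U₂ → f U₁ s ≤ f U₂ s
  path_mono : ∀ (U : Set V) (s u : V), IsSubtree G U → s ∉ U → u ∈ U → G.Adj s u →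
    f U u ≤ f (U ∪ {s}) s
  max_comp : ∀ (U : Set V) (s : V), IsSubtree G U → s ∈ U →
    f U s = ⨆ x ∈ U \ {s}, f (reachSet G (U \ {s}) x ∪ {s}) s

/-- `s` is a leaf of the (working) tree induced on `W`. -/
def IsLeafOf (G : SimpleGraph V) (W : Set V) (s : V) : Prop :=
  s ∈ W ∧ ∃! u, u ∈ W ∧ G.Adj s u

/-- The ordered pair `(u,v)` satisfies the peaking criterion in the working tree on `W`
with sink set `S` and threshold `𝒯`. -/
def PeakingPair (G : SimpleGraph V) (f : Set V → V → ℝ≥0∞) (𝒯 : ℝ≥0∞)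
    (W S : Set V) (u v : V) : Prop :=
  u ∈ W ∧ v ∈ W ∧ G.Adj u v ∧ S ∩ reachSet G (W \ {v}) u = ∅ ∧
    f (reachSet G (W \ {v}) u) u ≤ 𝒯 ∧ 𝒯 < f (reachSet G (W \ {v}) u ∪ {v}) v

/-- `w` lies on the unique path from `a` to `b` in the tree induced on `W`. -/
def OnPath (G : SimpleGraph V) (W : Set V) (a b w : V) : Prop :=
  a ∈ W ∧ b ∈ W ∧ w ∈ W ∧ b ∉ reachSet G (W \ {w}) a

/-- Vertices of the hub tree: union of the paths from the sinks to the root `r`. -/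
def hubVerts (G : SimpleGraph V) (W S : Set V) (r : V) : Set V :=
  {w | ∃ s ∈ S, OnPath G W s r w}

/-- `r` is a valid root: a non-sink vertex of the working tree such that at least two of
the subtrees hanging off it contain sinks. -/
def GoodRoot (G : SimpleGraph V) (W S : Set V) (r : V) : Prop :=
  r ∈ W ∧ r ∉ S ∧
    ∃ η₁ η₂ : V, η₁ ≠ η₂ ∧ η₁ ∈ W ∧ η₂ ∈ W ∧ G.Adj r η₁ ∧ G.Adj r η₂ ∧
      (S ∩ reachSet G (W \ {r}) η₁).Nonempty ∧ (S ∩ reachSet G (W \ {r}) η₂).Nonempty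

/-- The working tree on `W` is RC-viable w.r.t. sinks `S` and root `r`: every outstanding
branch, together with the hub-tree node it is attached to, has cost at most `𝒯`. -/
def RCViable (G : SimpleGraph V) (f : Set V → V → ℝ≥0∞) (𝒯 : ℝ≥0∞)
    (W S : Set V) (r : V) : Prop :=
  ∀ w ∈ hubVerts G W S r, ∀ η ∈ W, G.Adj w η → η ∉ hubVerts G W S r →
    f (reachSet G (W \ {w}) η ∪ {w}) w ≤ 𝒯

/-- The set `A` is self-sufficient: it can be partitioned into subtree blocks, one for
each sink in `S ∩ A`, each block containing its sink and having cost at most `𝒯`. -/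
def SelfSufficient (G : SimpleGraph V) (f : Set V → V → ℝ≥0∞) (𝒯 : ℝ≥0∞)
    (S A : Set V) : Prop :=
  ∃ P : V → Set V,
    (⋃ s ∈ S ∩ A, P s) = A ∧
    (∀ s ∈ S ∩ A, IsSubtree G (P s) ∧ s ∈ P s ∧ f (P s) s ≤ 𝒯) ∧
    (S ∩ A).Pairwise fun s t => Disjoint (P s) (P t)

/-- The vertices of the path `Π(a,b)` in the tree induced on `W`. -/
def pathSet (G : SimpleGraph V) (W : Set V) (a b : V) : Set V :=
  {w | OnPath G W a b w}

/-- All vertices of outstanding branches attached to `w` (given hub-tree vertices `Hub`). -/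
def branchesAt (G : SimpleGraph V) (W Hub : Set V) (w : V) : Set V :=
  ⋃ η ∈ {η : V | η ∈ W ∧ G.Adj w η ∧ η ∉ Hub}, reachSet G (W \ {w}) η

/-- The bulk path `BP(a,b)`: the path `Π(a,b)` together with all outstanding branches
attached to its vertices. -/
def bulkPath (G : SimpleGraph V) (W S : Set V) (r a b : V) : Set V :=
  pathSet G W a b ∪ ⋃ w ∈ pathSet G W a b, branchesAt G W (hubVerts G W S r) w

/-- `v` is the parent of `u` in the hub tree rooted at `r`. -/
def HubParent (G : SimpleGraph V) (W S : Set V) (r u v : V) : Prop :=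
  u ∈ hubVerts G W S r ∧ v ∈ hubVerts G W S r ∧ G.Adj u v ∧ OnPath G W u r v

/-- The ordered pair `(u,v)` satisfies the reaching criterion: `v` is the hub-tree parent
of `u`, `T₋ᵥ(u)` is self-sufficient, and `BP(v,v) ∪ V₋ᵥ(u)` is not self-sufficient. -/
def ReachingPair (G : SimpleGraph V) (f : Set V → V → ℝ≥0∞) (𝒯 : ℝ≥0∞)
    (W S : Set V) (r u v : V) : Prop :=
  HubParent G W S r u v ∧
  SelfSufficient G f 𝒯 S (reachSet G (W \ {v}) u) ∧
  ¬ SelfSufficient G f 𝒯 S (bulkPath G W S r v v ∪ reachSet G (W \ {v}) u)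

/-- The vertex set `V(v)` of the subtree of the working tree (rooted at `r`) rooted at `v`:
all vertices whose path to the root passes through `v`. -/
def rootedBelow (G : SimpleGraph V) (W : Set V) (r v : V) : Set V :=
  {x | OnPath G W x r v}

/-- The rooted subtree `T(v)` is RC-viable: every outstanding branch attached to a
hub-tree node lying in `T(v)` has, together with its attachment node, cost at most `𝒯`. -/
def RCViableBelow (G : SimpleGraph V) (f : Set V → V → ℝ≥0∞) (𝒯 : ℝ≥0∞)
    (W S : Set V) (r v : V) : Prop :=
  ∀ w ∈ hubVerts G W S r ∩ rootedBelow G W r v, ∀ η ∈ W, G.Adj w η →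
    η ∉ hubVerts G W S r → f (reachSet G (W \ {w}) η ∪ {w}) w ≤ 𝒯

/-- The subtree with vertex set `A` (of the working tree rooted at `r`) is recursively
self-sufficient: for every hub-tree node `w` in `A`, the part of `A` lying below `w`
is self-sufficient. -/
def RecursivelySelfSufficientOn (G : SimpleGraph V) (f : Set V → V → ℝ≥0∞) (𝒯 : ℝ≥0∞)
    (W S : Set V) (r : V) (A : Set V) : Prop :=
  ∀ w ∈ hubVerts G W S r ∩ A, SelfSufficient G f 𝒯 S (rootedBelow G W r w ∩ A)

/-- A feasible sink configuration: a partition of all of `V_in` into subtree blocks,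
one per sink, each block containing exactly its own sink and having cost at most `𝒯`. -/
def IsFeasibleConfig (G : SimpleGraph V) (f : Set V → V → ℝ≥0∞) (𝒯 : ℝ≥0∞)
    (St : Set V) (P : V → Set V) : Prop :=
  (⋃ s ∈ St, P s) = Set.univ ∧
  St.Pairwise (fun s t => Disjoint (P s) (P t)) ∧
  ∀ s ∈ St, IsSubtree G (P s) ∧ St ∩ P s = {s} ∧ f (P s) s ≤ 𝒯

/-- An optimal feasible sink configuration: one with the minimum number of sinks. -/
def IsOptimalConfig (G : SimpleGraph V) (f : Set V → V → ℝ≥0∞) (𝒯 : ℝ≥0∞)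
    (St : Set V) (P : V → Set V) : Prop :=
  IsFeasibleConfig G f 𝒯 St P ∧
  ∀ (St' : Set V) (P' : V → Set V), IsFeasibleConfig G f 𝒯 St' P' → St.ncard ≤ St'.ncard

/-- A partial sink configuration relative to the working tree on `W`: pairwise disjoint
subtree blocks of cost at most `𝒯`, one per sink of `Sout`, covering `V_in \ (W \ Sout)`. -/
def IsPartialConfig (G : SimpleGraph V) (f : Set V → V → ℝ≥0∞) (𝒯 : ℝ≥0∞)
    (W : Set V) (Sout : Set V) (P : V → Set V) : Prop :=
  Sout.Pairwise (fun s t => Disjoint (P s) (P t)) ∧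
  (∀ s ∈ Sout, IsSubtree G (P s) ∧ s ∈ P s ∧ f (P s) s ≤ 𝒯) ∧
  (⋃ s ∈ Sout, P s) = Set.univ \ (W \ Sout)

/-- `(St, Pt)` is an optimal feasible sink configuration witnessing the optimality of the
partial configuration `(Sout, P)` relative to the working tree on `W` (conditions (C1)-(C3)). -/
def WitnessesOptimality (G : SimpleGraph V) (f : Set V → V → ℝ≥0∞) (𝒯 : ℝ≥0∞)
    (W : Set V) (Sout : Set V) (P : V → Set V) (St : Set V) (Pt : V → Set V) : Prop :=
  IsOptimalConfig G f 𝒯 St Pt ∧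
  Sout ⊆ St ∧
  St \ W = Sout \ W ∧
  (∀ s ∈ Sout ∩ W, IsLeafOf G W s) ∧
  (∀ s ∈ St, s ∉ W → Pt s = P s ∧ Pt s ∩ W = ∅) ∧
  (∀ s ∈ Sout ∩ W, P s ⊆ Pt s ∧ Pt s \ P s ⊆ W) ∧
  (∀ s ∈ St, s ∉ Sout → Pt s ⊆ W)

/-- The partial sink configuration `(Sout, P)` is optimal relative to the working tree on `W`. -/
def OptimalRelative (G : SimpleGraph V) (f : Set V → V → ℝ≥0∞) (𝒯 : ℝ≥0∞)
    (W : Set V) (Sout : Set V) (P : V → Set V) : Prop :=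
  ∃ (St : Set V) (Pt : V → Set V), WitnessesOptimality G f 𝒯 W Sout P St Pt

theorem self_mem_reachSet {G : SimpleGraph V} {A : Set V} {u : V} (hu : u ∈ A) :
    u ∈ reachSet G A u :=
  ⟨hu, hu, Reachable.refl _⟩

theorem reachSet_subset (G : SimpleGraph V) (A : Set V) (u : V) : reachSet G A u ⊆ A :=
  fun _ ⟨_, hy, _⟩ => hy

theorem reachSet_adj {G : SimpleGraph V} {A : Set V} {u y z : V} (hy : y ∈ reachSet G A u)
    (hz : z ∈ A) (h : G.Adj y z) : z ∈ reachSet G A u := by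
  obtain ⟨hu, hyA, hr⟩ := hy
  have hadj : (G.induce A).Adj ⟨y, hyA⟩ ⟨z, hz⟩ := h
  exact ⟨hu, hz, hr.trans hadj.reachable⟩

theorem reachSet_induction {G : SimpleGraph V} {A : Set V} {u : V} {P : V → Prop} (base : P u)
    (step : ∀ y z, y ∈ reachSet G A u → z ∈ A → G.Adj y z → P y → P z) :
    ∀ y ∈ reachSet G A u, P y := by
  rintro y ⟨hu, hy, hr⟩
  rw [reachable_iff_reflTransGen] at hr
  suffices h : ∀ w : A, Relation.ReflTransGen (G.induce A).Adj ⟨u, hu⟩ w → P w from h _ hr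
  intro w hw
  induction hw with
  | refl => exact base
  | @tail b c hb hbc ih =>
    exact step b c ⟨hu, b.2, (reachable_iff_reflTransGen _ _).2 hb⟩ c.2 hbc ih

theorem reachSet_eq_of_mem {G : SimpleGraph V} {A : Set V} {u w : V}
    (hw : w ∈ reachSet G A u) : reachSet G A w = reachSet G A u := by
  obtain ⟨hu, hwA, hr⟩ := hw
  ext y
  exact ⟨fun ⟨_, hy, h⟩ => ⟨hu, hy, hr.trans h⟩, fun ⟨_, hy, h⟩ => ⟨hwA, hy, hr.symm.trans h⟩⟩

theorem isSubtree_reachSet {G : SimpleGraph V} {A : Set V} {u : V} (hu : u ∈ A) :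
    IsSubtree G (reachSet G A u) := by
  have h : ∀ y ∈ reachSet G A u, y ∈ reachSet G (reachSet G A u) u :=
    reachSet_induction (self_mem_reachSet (self_mem_reachSet hu))
      fun y z hy hz hyz ih => reachSet_adj ih (reachSet_adj hy hz hyz) hyz
  refine connected_iff_exists_forall_reachable _ |>.2
    ⟨⟨u, self_mem_reachSet hu⟩, fun ⟨y, hy⟩ => ?_⟩
  obtain ⟨_, _, hr⟩ := h y hy
  exact hr

/-- Every component of `R \ {u}` of a subtree `R` contains a neighbour of `u`. -/
theorem exists_adj_mem_reachSet_diff {G : SimpleGraph V} {R : Set V} (hR : IsSubtree G R)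
    {u x : V} (hu : u ∈ R) (hx : x ∈ R \ {u}) :
    ∃ w ∈ reachSet G (R \ {u}) x, G.Adj w u := by
  by_contra! hno
  have h : ∀ y ∈ reachSet G R x, y ∈ reachSet G (R \ {u}) x := by
    refine reachSet_induction (self_mem_reachSet hx) fun y z _ hz hyz ih => ?_
    refine reachSet_adj ih ⟨hz, ?_⟩ hyz
    rintro rfl
    exact hno y ih hyz
  exact (reachSet_subset _ _ _ (h u ⟨hx.1, hu, hR.preconnected _ _⟩)).2 rfl

/-- In an acyclic graph, the component of `W \ {v}` containing a neighbour `u` of `v` contains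
no other neighbour of `v`. -/
theorem eq_of_mem_reachSet_of_adj {G : SimpleGraph V} (hG : G.IsAcyclic) {W : Set V} {u v y : V}
    (huv : G.Adj u v) (hy : y ∈ reachSet G (W \ {v}) u) (hyv : G.Adj y v) : y = u := by
  by_contra hne
  have hb : ¬ (G.deleteEdges {s(u, v)}).Reachable u v :=
    isBridge_iff.1 (isAcyclic_iff_forall_adj_isBridge.1 hG huv)
  have hr : ∀ y ∈ reachSet G (W \ {v}) u, (G.deleteEdges {s(u, v)}).Reachable u y := by
    refine reachSet_induction (Reachable.refl _) fun a b ha hb hab ih => ih.trans ?_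
    have hav : a ≠ v := (reachSet_subset _ _ _ ha).2
    have hbv : b ≠ v := hb.2
    refine Adj.reachable ?_
    simp [deleteEdges_adj, hab, hav, hbv]
  refine hb ((hr y hy).trans (Adj.reachable ?_))
  have hyv' := hyv.ne
  simp [deleteEdges_adj, hyv, hne, hyv']

theorem reachSet_reachSet_diff {G : SimpleGraph V} (hG : G.IsAcyclic) {W : Set V} {u v w : V}
    (huv : G.Adj u v) (hw : w ∈ reachSet G (W \ {v}) u \ {u}) :
    reachSet G (reachSet G (W \ {v}) u \ {u}) w = reachSet G (W \ {u}) w := by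
  have hRW : reachSet G (W \ {v}) u ⊆ W := (reachSet_subset _ _ _).trans sdiff_subset
  apply Subset.antisymm
  · refine reachSet_induction (self_mem_reachSet ⟨hRW hw.1, hw.2⟩) fun y z _ hz hyz ih => ?_
    exact reachSet_adj ih ⟨hRW hz.1, hz.2⟩ hyz
  · refine reachSet_induction (self_mem_reachSet hw) fun y z _ hz hyz ih => ?_
    have hyR := reachSet_subset _ _ _ ih
    refine reachSet_adj ih ⟨reachSet_adj hyR.1 ⟨hz.1, ?_⟩ hyz, hz.2⟩ hyz
    rintro rfl
    exact hyR.2 (eq_of_mem_reachSet_of_adj hG huv hyR.1 hyz)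

/-- Lemma `PCRecurseInto`: if `f(V₋ᵥ(u) ∪ {v}, v) > 𝒯` and
`S ∩ V₋ᵥ(u) = ∅`, then some ordered pair `(u',v')` with `u',v' ∈ V₋ᵥ(u) ∪ {v}` satisfies
the peaking criterion. -/
theorem statement_0 [Fintype V] (G : SimpleGraph V) (hG : G.IsTree)
    (f : Set V → V → ℝ≥0∞) (hf : IsMinmaxMonotone G f) (𝒯 : ℝ≥0∞)
    (W S : Set V) (hW : IsSubtree G W) (hSW : S ⊆ W)
    (hSleaf : ∀ s ∈ S, IsLeafOf G W s)
    (u v : V) (hu : u ∈ W) (hv : v ∈ W) (huv : G.Adj u v)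
    (hcost : 𝒯 < f (reachSet G (W \ {v}) u ∪ {v}) v)
    (hS : S ∩ reachSet G (W \ {v}) u = ∅) :
    ∃ u' v' : V, u' ∈ reachSet G (W \ {v}) u ∪ {v} ∧ v' ∈ reachSet G (W \ {v}) u ∪ {v} ∧
      PeakingPair G f 𝒯 W S u' v' := by
  induction hn : (reachSet G (W \ {v}) u).ncard using Nat.strong_induction_on
    generalizing u v with
  | _ n ih =>
    have huR : u ∈ reachSet G (W \ {v}) u := self_mem_reachSet ⟨hu, huv.ne⟩
    by_cases hle : f (reachSet G (W \ {v}) u) u ≤ 𝒯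
    · exact ⟨u, v, Or.inl huR, Or.inr rfl, hu, hv, huv, hS, hle, hcost⟩
    have hR : IsSubtree G (reachSet G (W \ {v}) u) := isSubtree_reachSet ⟨hu, huv.ne⟩
    rw [not_le, hf.max_comp _ _ hR huR] at hle
    simp only [lt_iSup_iff] at hle
    obtain ⟨x, hx, hlt⟩ := hle
    obtain ⟨w, hwx, hwu⟩ := exists_adj_mem_reachSet_diff hR huR hx
    have hw := reachSet_subset _ _ _ hwx
    have heq := reachSet_reachSet_diff hG.isAcyclic huv hw
    rw [← reachSet_eq_of_mem hwx, heq] at hlt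
    have hsub : reachSet G (W \ {u}) w ⊆ reachSet G (W \ {v}) u \ {u} :=
      heq ▸ reachSet_subset _ _ _
    have hcard : (reachSet G (W \ {u}) w).ncard < n := hn ▸
      ncard_lt_ncard ⟨hsub.trans sdiff_subset, fun h => (hsub (h huR)).2 rfl⟩ (toFinite _)
    have hS' : S ∩ reachSet G (W \ {u}) w = ∅ :=
      subset_eq_empty (inter_subset_inter_right _ (hsub.trans sdiff_subset)) hS
    obtain ⟨u', v', hu', hv', hp⟩ :=
      ih _ hcard w u (reachSet_subset _ _ _ hw.1).1 hu hwu hlt hS' rfl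
    have hsub' : reachSet G (W \ {u}) w ∪ {u} ⊆ reachSet G (W \ {v}) u ∪ {v} :=
      union_subset (fun y hy => Or.inl (hsub hy).1) (by simpa using Or.inr huR)
    exact ⟨u', v', hsub' hu', hsub' hv', hp⟩
end

section
/- (Reaching Lemma) Let f be a minmax monotone cost function on a finite tree T_in, 𝒯 ≥ 0, T = (V,E) a working subtree with sink set S = S_out ∩ V, and let (S_out, P_out) be a partial sink configuration that is optimal relative to T. Suppose T is RC-viable with respect to S and the ordered pair (u,v) of hub-tree nodes satisfies the reaching criterion. Let {P'_s : s ∈ S ∩ V_{-v}(u)} be a partition of V_{-v}(u) witnessing the self-sufficiency of T_{-v}(u). Then the configuration obtained by replacing P_s with P_s ∪ P'_s for each s ∈ S ∩ V_{-v}(u), and replacing the working tree by the subtree of T induced on V \ V_{-v}(u), is again a partial sink configuration that is optimal relative to the new working tree. -/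
open SimpleGraph Set
open scoped ENNReal

variable {V : Type*}

section Subtrees

variable {G : SimpleGraph V} {A B C K : Set V} {s t u v x y : V}

theorem mem_of_mem_support_map_induce {a b : A} (p : (G.induce A).Walk a b) :
    ∀ z ∈ (p.map (Embedding.induce A).toHom).support, z ∈ A := by
  intro z hz
  rw [Walk.support_map, List.mem_map] at hz
  obtain ⟨w, -, rfl⟩ := hz
  exact w.2

theorem mem_reachSet_iff :
    y ∈ reachSet G A x ↔ ∃ p : G.Walk x y, ∀ z ∈ p.support, z ∈ A := by
  constructor
  · rintro ⟨hx, hy, ⟨p⟩⟩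
    exact ⟨p.map (Embedding.induce A).toHom, mem_of_mem_support_map_induce p⟩
  · rintro ⟨p, hp⟩
    exact ⟨hp _ p.start_mem_support, hp _ p.end_mem_support, ⟨p.induce A hp⟩⟩

theorem reachSet_subset_s4 : reachSet G A x ⊆ A := fun _ ⟨_, hy, _⟩ => hy

theorem mem_reachSet_self (hx : x ∈ A) : x ∈ reachSet G A x :=
  ⟨hx, hx, Reachable.refl _⟩

theorem mem_of_mem_reachSet (h : y ∈ reachSet G A x) : x ∈ A := h.1

theorem reachSet_symm (h : y ∈ reachSet G A x) : x ∈ reachSet G A y := by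
  obtain ⟨hx, hy, h⟩ := h
  exact ⟨hy, hx, h.symm⟩

theorem reachSet_trans {z : V} (h : y ∈ reachSet G A x) (h' : z ∈ reachSet G A y) :
    z ∈ reachSet G A x :=
  ⟨h.1, h'.2.1, h.2.2.trans h'.2.2⟩

theorem reachSet_step (h : x ∈ reachSet G A u) (hy : y ∈ A) (hxy : G.Adj x y) :
    y ∈ reachSet G A u := by
  obtain ⟨hu, hx, h⟩ := h
  exact ⟨hu, hy, h.trans (Adj.reachable (G := G.induce A) (u := ⟨x, hx⟩) (v := ⟨y, hy⟩) hxy)⟩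

theorem reachSet_mono (h : A ⊆ B) : reachSet G A x ⊆ reachSet G B x := by
  intro y hy
  rw [mem_reachSet_iff] at hy ⊢
  obtain ⟨p, hp⟩ := hy
  exact ⟨p, fun z hz => h (hp z hz)⟩

theorem IsSubtree.mem_reachSet (hA : IsSubtree G A) (hx : x ∈ A) (hy : y ∈ A) :
    y ∈ reachSet G A x :=
  ⟨hx, hy, hA.preconnected _ _⟩

theorem isSubtree_of_forall (hv : v ∈ A)
    (h : ∀ x ∈ A, ∃ B ⊆ A, IsSubtree G B ∧ v ∈ B ∧ x ∈ B) : IsSubtree G A := by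
  have key : ∀ x ∈ A, x ∈ reachSet G A v := fun x hx => by
    obtain ⟨B, hBA, hB, hvB, hxB⟩ := h x hx
    exact reachSet_mono hBA (hB.mem_reachSet hvB hxB)
  refine (connected_iff _).2 ⟨?_, ⟨v, hv⟩⟩
  rintro ⟨x, hx⟩ ⟨y, hy⟩
  exact (reachSet_trans (reachSet_symm (key x hx)) (key y hy)).2.2

theorem isSubtree_of_forall_mem_reachSet (hv : v ∈ A) (h : ∀ x ∈ A, x ∈ reachSet G A v) :
    IsSubtree G A := by
  refine (connected_iff _).2 ⟨?_, ⟨v, hv⟩⟩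
  rintro ⟨x, hx⟩ ⟨y, hy⟩
  exact (reachSet_trans (reachSet_symm (h x hx)) (h y hy)).2.2

theorem isSubtree_reachSet_s4 (hx : x ∈ A) : IsSubtree G (reachSet G A x) := by
  refine isSubtree_of_forall_mem_reachSet (mem_reachSet_self hx) fun y hy => ?_
  obtain ⟨p, hp⟩ := mem_reachSet_iff.1 hy
  refine mem_reachSet_iff.2 ⟨p, fun z hz => ?_⟩
  classical
  exact mem_reachSet_iff.2
    ⟨p.takeUntil z hz, fun w hw => hp w (p.support_takeUntil_subset_support hz hw)⟩

theorem IsSubtree.subset_reachSet (hA : IsSubtree G A) (hAB : A ⊆ B) (hx : x ∈ A) :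
    A ⊆ reachSet G B x :=
  fun _ hy => reachSet_mono hAB (hA.mem_reachSet hx hy)

theorem IsSubtree.union (hA : IsSubtree G A) (hB : IsSubtree G B) (hxA : x ∈ A) (hxB : x ∈ B) :
    IsSubtree G (A ∪ B) := by
  refine isSubtree_of_forall (Or.inl hxA) ?_
  rintro y (hy | hy)
  · exact ⟨A, subset_union_left, hA, hxA, hy⟩
  · exact ⟨B, subset_union_right, hB, hxB, hy⟩

theorem IsSubtree.union_singleton (hA : IsSubtree G A) (hx : x ∈ A) (hxy : G.Adj x y) :
    IsSubtree G (A ∪ {y}) := by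
  refine isSubtree_of_forall_mem_reachSet (Or.inl hx) ?_
  have hA' := hA.subset_reachSet (B := A ∪ {y}) subset_union_left hx
  rintro z (hz | rfl)
  · exact hA' hz
  · exact reachSet_step (hA' hx) (Or.inr rfl) hxy

theorem IsSubtree.exists_boundary (hK : IsSubtree G K) (X : Set V) (hx : x ∈ K) (hxX : x ∈ X)
    (hy : y ∈ K) (hyX : y ∉ X) : ∃ a ∈ K, ∃ b ∈ K, a ∈ X ∧ b ∉ X ∧ G.Adj a b := by
  obtain ⟨p⟩ := hK.preconnected ⟨x, hx⟩ ⟨y, hy⟩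
  obtain ⟨d, -, h1, h2⟩ := p.exists_boundary_dart {z | z.1 ∈ X} hxX hyX
  exact ⟨d.fst.1, d.fst.2, d.snd.1, d.snd.2, h1, h2, d.adj⟩

theorem IsSubtree.support_subset (hG : G.IsAcyclic) (hA : IsSubtree G A) (hx : x ∈ A)
    (hy : y ∈ A) {p : G.Walk x y} (hp : p.IsPath) : ∀ z ∈ p.support, z ∈ A := by
  obtain ⟨q, hq⟩ := hA.exists_isPath ⟨x, hx⟩ ⟨y, hy⟩
  have hq' : (q.map (Embedding.induce A).toHom).IsPath :=
    hq.map (Embedding.induce (G := G) A).injective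
  have h := (hG.subsingleton_path x y).elim ⟨p, hp⟩ ⟨_, hq'⟩
  have h' : p = q.map (Embedding.induce A).toHom := congrArg Subtype.val h
  intro z hz
  rw [h'] at hz
  exact mem_of_mem_support_map_induce q z hz

theorem IsSubtree.inter (hG : G.IsTree) (hA : IsSubtree G A) (hB : IsSubtree G B)
    (hxA : x ∈ A) (hxB : x ∈ B) : IsSubtree G (A ∩ B) := by
  refine isSubtree_of_forall_mem_reachSet ⟨hxA, hxB⟩ fun y hy => ?_
  obtain ⟨p, hp⟩ := hG.connected.exists_isPath x y
  exact mem_reachSet_iff.2 ⟨p, fun z hz =>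
    ⟨hA.support_subset hG.isAcyclic hxA hy.1 hp z hz,
      hB.support_subset hG.isAcyclic hxB hy.2 hp z hz⟩⟩

theorem IsSubtree.eq_of_adj (hG : G.IsTree) (hC : IsSubtree G C) (hv : v ∉ C) (hx : x ∈ C)
    (hy : y ∈ C) (hxv : G.Adj x v) (hyv : G.Adj y v) : x = y := by
  by_contra hne
  have hp : (Walk.cons hxv (Walk.cons hyv.symm Walk.nil)).IsPath := by
    simp [hne, hxv.ne, hyv.ne']
  exact hv (hC.support_subset hG.isAcyclic hx hy hp v (by simp))

/-- The only edge of `W` leaving the component of `W \ {v}` at a neighbour `u` of `v`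
is the edge between `u` and `v`. -/
theorem eq_of_adj_reachSet (hG : G.IsTree) {W : Set V} (huv : G.Adj u v)
    (hx : x ∈ reachSet G (W \ {v}) u) (hy : y ∈ W) (hy' : y ∉ reachSet G (W \ {v}) u)
    (hxy : G.Adj x y) : x = u ∧ y = v := by
  obtain rfl : y = v := by
    by_contra h
    exact hy' (reachSet_step hx ⟨hy, h⟩ hxy)
  have hu := mem_of_mem_reachSet hx
  exact ⟨(isSubtree_reachSet_s4 hu).eq_of_adj hG (fun h => (reachSet_subset_s4 h).2 rfl) hx
    (mem_reachSet_self hu) hxy huv, rfl⟩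

theorem IsSubtree.mem_of_crosses (hG : G.IsTree) {W : Set V} (huv : G.Adj u v)
    (hK : IsSubtree G K) (hKW : K ⊆ W) (hx : x ∈ K) (hxR : x ∈ reachSet G (W \ {v}) u)
    (hy : y ∈ K) (hyR : y ∉ reachSet G (W \ {v}) u) : u ∈ K ∧ v ∈ K := by
  obtain ⟨a, ha, b, hb, haR, hbR, hab⟩ := hK.exists_boundary _ hx hxR hy hyR
  obtain ⟨rfl, rfl⟩ := eq_of_adj_reachSet hG huv haR (hKW hb) hbR hab
  exact ⟨ha, hb⟩

theorem IsSubtree.diff_reachSet (hG : G.IsTree) {W : Set V} (hW : IsSubtree G W) (hv : v ∈ W)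
    (huv : G.Adj u v) : IsSubtree G (W \ reachSet G (W \ {v}) u) := by
  set R := reachSet G (W \ {v}) u
  have hvR : v ∉ R := fun h => (reachSet_subset_s4 h).2 rfl
  refine isSubtree_of_forall_mem_reachSet ⟨hv, hvR⟩ fun y hy => ?_
  by_contra hyD
  have hvD : v ∈ reachSet G (W \ R) v := mem_reachSet_self ⟨hv, hvR⟩
  obtain ⟨a, ha, b, hb, haX, hbX, hab⟩ :=
    hW.exists_boundary (reachSet G (W \ R) v ∪ R) hv (Or.inl hvD) hy.1 (by simp [hyD, hy.2])
  rw [mem_union, not_or] at hbX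
  rcases haX with haX | haX
  · exact hbX.1 (reachSet_step haX ⟨hb, hbX.2⟩ hab)
  · exact hbX.1 ((eq_of_adj_reachSet hG huv haX hb hbX.2 hab).2 ▸ hvD)

theorem IsSubtree.exists_adj_mem_reachSet {U : Set V} (hU : IsSubtree G U) (ht : t ∈ U)
    (hv : v ∈ U) (htv : t ≠ v) : ∃ x ∈ U, G.Adj t x ∧ v ∈ reachSet G (U \ {t}) x := by
  have hvA : v ∈ reachSet G (U \ {t}) v := mem_reachSet_self ⟨hv, htv.symm⟩
  obtain ⟨a, ha, b, hb, haX, hbX, hab⟩ :=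
    hU.exists_boundary (reachSet G (U \ {t}) v) hv hvA ht fun h => (reachSet_subset_s4 h).2 rfl
  obtain rfl : b = t := by
    by_contra h
    exact hbX (reachSet_step haX ⟨hb, h⟩ hab)
  exact ⟨a, ha, hab.symm, reachSet_symm haX⟩

end Subtrees

section Cost

variable {G : SimpleGraph V} {f : Set V → V → ℝ≥0∞} {𝒯 : ℝ≥0∞} {s t u v x y : V}

theorem IsMinmaxMonotone.cost_le_of_forall (hf : IsMinmaxMonotone G f) {U : Set V}
    (hU : IsSubtree G U) (hs : s ∈ U)
    (h : ∀ x ∈ U, x ≠ s → ∃ B, IsSubtree G B ∧ s ∈ B ∧ f B s ≤ 𝒯 ∧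
      reachSet G (U \ {s}) x ⊆ B) : f U s ≤ 𝒯 := by
  rw [hf.max_comp U s hU hs]
  refine iSup₂_le fun x hx => ?_
  obtain ⟨B, hB, hsB, hle, hsub⟩ := h x hx.1 hx.2
  obtain ⟨y, hy, hsy, hxy⟩ := hU.exists_adj_mem_reachSet hs hx.1 (Ne.symm hx.2)
  refine (hf.set_mono _ B s ?_ hB (Or.inr rfl)
    (union_subset hsub (singleton_subset_iff.2 hsB))).trans hle
  exact (isSubtree_reachSet_s4 hx).union_singleton (reachSet_symm hxy) hsy.symm

/-- Two subtrees meeting only in a common sink can be merged without exceeding the threshold. -/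
theorem IsMinmaxMonotone.cost_union_le (hf : IsMinmaxMonotone G f) (hG : G.IsTree)
    {A B : Set V} (hA : IsSubtree G A) (hB : IsSubtree G B) (hAB : A ∩ B = {s})
    (hfA : f A s ≤ 𝒯) (hfB : f B s ≤ 𝒯) : f (A ∪ B) s ≤ 𝒯 := by
  have hs : s ∈ A ∩ B := hAB ▸ rfl
  have key : ∀ A B : Set V, IsSubtree G A → IsSubtree G B → A ∩ B = {s} →
      ∀ x ∈ A, x ≠ s → reachSet G ((A ∪ B) \ {s}) x ⊆ A := by
    intro A B hA hB hAB x hxA hxs y hy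
    have hs : s ∈ A ∩ B := hAB ▸ rfl
    by_contra hyA
    have hx : x ∈ (A ∪ B) \ {s} := ⟨Or.inl hxA, hxs⟩
    obtain ⟨a, ha, b, hb, haA, hbA, hab⟩ :=
      (isSubtree_reachSet_s4 hx).exists_boundary A (mem_reachSet_self hx) hxA hy hyA
    have has : a ≠ s := (reachSet_subset_s4 ha).2
    have hbs : b ≠ s := (reachSet_subset_s4 hb).2
    have hbB : b ∈ B := (reachSet_subset_s4 hb).1.resolve_left hbA
    have hsb : IsSubtree G ((A ∪ {b}) ∩ B) :=
      (hA.union_singleton haA hab).inter hG hB (Or.inl hs.1) hs.2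
    obtain ⟨c, hc, d, hd, hcX, hdX, hcd⟩ :=
      hsb.exists_boundary {s} ⟨Or.inl hs.1, hs.2⟩ rfl ⟨Or.inr rfl, hbB⟩ hbs
    obtain rfl : c = s := hcX
    obtain rfl : d = b := by
      rcases hd.1 with h | h
      · exact absurd (hAB ▸ (⟨h, hd.2⟩ : d ∈ A ∩ B)) hdX
      · exact h
    exact has (hA.eq_of_adj hG hbA haA hs.1 hab hcd)
  refine hf.cost_le_of_forall (hA.union hB hs.1 hs.2) (Or.inl hs.1) fun x hx hxs => ?_
  rcases hx with hx | hx
  · exact ⟨A, hA, hs.1, hfA, key A B hA hB hAB x hx hxs⟩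
  · exact ⟨B, hB, hs.2, hfB, by
      rw [union_comm]
      exact key B A hB hA (by rw [inter_comm, hAB]) x hx hxs⟩

/-- If a subtree `K` of `U` is attached to the rest of `U` only at `v`, then evacuating `K`
to `v` costs at most as much as evacuating `U` to any vertex that is not in `K \ {v}`. -/
theorem IsMinmaxMonotone.cost_le_of_attached [Finite V] (hf : IsMinmaxMonotone G f)
    {K U : Set V} (hU : IsSubtree G U) (hK : IsSubtree G K) (hKU : K ⊆ U) (hv : v ∈ K)
    (ht : t ∈ U) (htK : t ∈ K → t = v)
    (hatt : ∀ x ∈ K, ∀ y ∈ U, y ∉ K → G.Adj x y → x = v) : f K v ≤ f U t := by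
  induction h : U.ncard using Nat.strong_induction_on generalizing U t with
  | _ n ih =>
    by_cases htv : t = v
    · subst htv
      exact hf.set_mono _ _ _ hK hU hv hKU
    have htK' : t ∉ K := fun h => htv (htK h)
    obtain ⟨x, hx, htx, hxv⟩ := hU.exists_adj_mem_reachSet ht (hKU hv) htv
    have hxt : x ∈ U \ {t} := ⟨hx, htx.ne'⟩
    have hsub : reachSet G (U \ {t}) x ⊆ U := fun y hy => (reachSet_subset_s4 hy).1
    have htC : t ∉ reachSet G (U \ {t}) x := fun h => (reachSet_subset_s4 h).2 rfl
    have hC := isSubtree_reachSet_s4 (G := G) hxt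
    have hxC := mem_reachSet_self (G := G) hxt
    have hKC : K ⊆ reachSet G (U \ {t}) x := fun y hy => reachSet_trans hxv
      (hK.subset_reachSet (B := U \ {t}) (fun z hz => ⟨hKU hz, fun h => htK' (h ▸ hz)⟩) hv hy)
    have hlt : (reachSet G (U \ {t}) x).ncard < n :=
      h ▸ Set.ncard_lt_ncard (hsub.ssubset_of_mem_notMem ht htC)
    refine (ih _ hlt (U := reachSet G (U \ {t}) x) (t := x) hC hKC hxC
      (fun h => hatt x h t ht htK' htx.symm)
      (fun a ha b hb => hatt a ha b (hsub hb)) rfl).trans ?_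
    refine (hf.path_mono _ t x hC htC hxC htx).trans ?_
    exact hf.set_mono _ _ _ (hC.union_singleton hxC htx.symm) hU (Or.inr rfl)
      (union_subset hsub (singleton_subset_iff.2 ht))

end Cost

section Configurations

variable {G : SimpleGraph V} {f : Set V → V → ℝ≥0∞} {𝒯 : ℝ≥0∞} {W Sout : Set V}
  {P : V → Set V}

theorem IsPartialConfig.eq_of_mem (h : IsPartialConfig G f 𝒯 W Sout P) {s x : V}
    (hs : s ∈ Sout) (hx : x ∈ P s) (hxW : x ∈ W) : x = s := by
  have hxS : x ∈ Sout := by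
    have h' : x ∈ Set.univ \ (W \ Sout) := h.2.2 ▸ mem_biUnion hs hx
    by_contra hxS
    exact h'.2 ⟨hxW, hxS⟩
  by_contra hne
  exact (h.1 hxS hs hne).le_bot ⟨(h.2.1 x hxS).2.1, hx⟩

open Classical in
/-- To extend a partial configuration to an optimal one it suffices to give the blocks of the
sinks in the working tree. -/
theorem IsPartialConfig.optimalRelative (h : IsPartialConfig G f 𝒯 W Sout P)
    (hleaf : ∀ s ∈ Sout ∩ W, IsLeafOf G W s) {St : Set V} {Q : V → Set V}
    (hSt : Sout ⊆ St) (hStW : ∀ s ∈ St, s ∉ W → s ∈ Sout)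
    (hQ : ∀ s ∈ St ∩ W, IsSubtree G (Q s) ∧ s ∈ Q s ∧ f (Q s) s ≤ 𝒯)
    (hQold : ∀ s ∈ Sout ∩ W, P s ⊆ Q s ∧ Q s \ P s ⊆ W)
    (hQnew : ∀ s ∈ St ∩ W, s ∉ Sout → Q s ⊆ W)
    (hdisj : (St ∩ W).Pairwise fun s t => Disjoint (Q s) (Q t))
    (hcover : ∀ x ∈ W, ∃ s ∈ St ∩ W, x ∈ Q s)
    (hmin : ∀ St' P', IsFeasibleConfig G f 𝒯 St' P' → St.ncard ≤ St'.ncard) :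
    OptimalRelative G f 𝒯 W Sout P := by
  have hPW : ∀ s ∈ Sout, s ∉ W → P s ∩ W = ∅ := fun s hs hsW =>
    eq_empty_of_forall_notMem fun x hx => hsW (h.eq_of_mem hs hx.1 hx.2 ▸ hx.2)
  have hcross : ∀ a ∈ St, a ∉ W → ∀ s ∈ St, s ∈ W → Disjoint (P a) (Q s) := by
    intro a ha haW s hs hsW
    rw [Set.disjoint_left]
    intro x hxa hxs
    have haS := hStW a ha haW
    have hxW : x ∉ W := fun hx => (hPW a haS haW).le ⟨hxa, hx⟩
    by_cases hsS : s ∈ Sout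
    · have hxP : x ∈ P s := by
        by_contra hxP
        exact hxW ((hQold s ⟨hsS, hsW⟩).2 ⟨hxs, hxP⟩)
      exact (h.1 haS hsS fun e => haW (e ▸ hsW)).le_bot ⟨hxa, hxP⟩
    · exact hxW (hQnew s ⟨hs, hsW⟩ hsS hxs)
  have hblock : ∀ s ∈ St, IsSubtree G (if s ∈ W then Q s else P s) ∧
      s ∈ (if s ∈ W then Q s else P s) ∧ f (if s ∈ W then Q s else P s) s ≤ 𝒯 := by
    intro s hs
    split_ifs with hsW
    · exact hQ s ⟨hs, hsW⟩
    · exact h.2.1 s (hStW s hs hsW)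
  have hpair : St.Pairwise fun s t =>
      Disjoint (if s ∈ W then Q s else P s) (if t ∈ W then Q t else P t) := by
    intro s hs t ht hst
    by_cases hsW : s ∈ W <;> by_cases htW : t ∈ W <;> simp only [hsW, htW, if_true, if_false]
    · exact hdisj ⟨hs, hsW⟩ ⟨ht, htW⟩ hst
    · exact (hcross t ht htW s hs hsW).symm
    · exact hcross s hs hsW t ht htW
    · exact h.1 (hStW s hs hsW) (hStW t ht htW) hst
  refine ⟨St, fun s => if s ∈ W then Q s else P s, ⟨⟨?_, hpair, ?_⟩, hmin⟩, hSt, ?_, hleaf,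
    ?_, ?_, ?_⟩
  · refine eq_univ_of_forall fun x => mem_iUnion₂.2 ?_
    by_cases hxW : x ∈ W
    · obtain ⟨s, hs, hxs⟩ := hcover x hxW
      exact ⟨s, hs.1, by simpa only [if_pos hs.2] using hxs⟩
    · have hx : x ∈ ⋃ s ∈ Sout, P s := h.2.2 ▸ ⟨trivial, fun h => hxW h.1⟩
      obtain ⟨s, hs, hxs⟩ := mem_iUnion₂.1 hx
      refine ⟨s, hSt hs, ?_⟩
      dsimp only
      split_ifs with hsW
      · exact (hQold s ⟨hs, hsW⟩).1 hxs
      · exact hxs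
  · intro s hs
    refine ⟨(hblock s hs).1, ?_, (hblock s hs).2.2⟩
    refine Subset.antisymm (fun x hx => ?_) (singleton_subset_iff.2 ⟨hs, (hblock s hs).2.1⟩)
    by_contra hne
    exact (hpair hx.1 hs hne).le_bot ⟨(hblock x hx.1).2.1, hx.2⟩
  · ext s
    exact ⟨fun hs => ⟨hStW s hs.1 hs.2, hs.2⟩, fun hs => ⟨hSt hs.1, hs.2⟩⟩
  · intro s hs hsW
    simp only [if_neg hsW, true_and]
    exact hPW s (hStW s hs hsW) hsW
  · intro s hs
    simpa only [if_pos hs.2] using hQold s hs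
  · intro s hs hsS
    have hsW : s ∈ W := by
      by_contra hsW
      exact hsS (hStW s hs hsW)
    simpa only [if_pos hsW] using hQnew s ⟨hs, hsW⟩ hsS

end Configurations

section Fans

variable {G : SimpleGraph V} {f : Set V → V → ℝ≥0∞} {𝒯 : ℝ≥0∞} {W S F K : Set V}
  {r s u v x y η : V}

/-- `F` consists of the vertex `v` and some of the components of `W \ {v}` adjacent to `v`. -/
def IsFan (G : SimpleGraph V) (W : Set V) (v : V) (F : Set V) : Prop :=
  v ∈ F ∧ ∀ x ∈ F, x = v ∨
    ∃ η, G.Adj η v ∧ x ∈ reachSet G (W \ {v}) η ∧ reachSet G (W \ {v}) η ⊆ F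

theorem notMem_reachSet_diff_singleton : v ∉ reachSet G (W \ {v}) u :=
  fun h => (reachSet_subset_s4 h).2 rfl

theorem isSubtree_reachSet_union_singleton (huv : G.Adj u v)
    (hx : x ∈ reachSet G (W \ {v}) u) : IsSubtree G (reachSet G (W \ {v}) u ∪ {v}) :=
  (isSubtree_reachSet_s4 (mem_of_mem_reachSet hx)).union_singleton
    (mem_reachSet_self (mem_of_mem_reachSet hx)) huv

theorem IsFan.isSubtree (hF : IsFan G W v F) : IsSubtree G F := by
  refine isSubtree_of_forall hF.1 fun x hx => ?_
  rcases hF.2 x hx with rfl | ⟨η, hη, hxη, hsub⟩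
  · exact ⟨{x}, singleton_subset_iff.2 hx,
      isSubtree_of_forall_mem_reachSet (v := x) rfl
        (fun y hy => by rw [mem_singleton_iff.1 hy]; exact mem_reachSet_self rfl), rfl, rfl⟩
  · exact ⟨_, union_subset hsub (singleton_subset_iff.2 hF.1),
      isSubtree_reachSet_union_singleton hη hxη, Or.inr rfl, Or.inl hxη⟩

theorem IsFan.mem_of_crosses (hG : G.IsTree) (hF : IsFan G W v F) (hK : IsSubtree G K)
    (hKW : K ⊆ W) (hx : x ∈ K) (hxF : x ∈ F) (hy : y ∈ K) (hyF : y ∉ F) : v ∈ K := by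
  rcases hF.2 x hxF with rfl | ⟨η, hη, hxη, hsub⟩
  · exact hx
  · exact (hK.mem_of_crosses hG hη hKW hx hxη hy fun h => hyF (hsub h)).2

theorem mem_bulkPath_self (hv : v ∈ W) :
    x ∈ bulkPath G W S r v v ↔ x = v ∨ ∃ η, η ∈ W ∧ G.Adj v η ∧ η ∉ hubVerts G W S r ∧
      x ∈ reachSet G (W \ {v}) η := by
  have hpath : pathSet G W v v = {v} := by
    ext w
    constructor
    · rintro ⟨-, -, -, h⟩
      by_contra hne
      exact h (mem_reachSet_self ⟨hv, fun e => hne (mem_singleton_iff.1 e).symm⟩)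
    · rintro rfl
      exact ⟨hv, hv, hv, notMem_reachSet_diff_singleton⟩
  simp only [bulkPath, hpath, branchesAt, mem_union, mem_singleton_iff, mem_iUnion, exists_prop,
    exists_eq_left, mem_ofPred_eq, and_assoc]

theorem isFan_bulkPath (hv : v ∈ W) : IsFan G W v (bulkPath G W S r v v) := by
  refine ⟨(mem_bulkPath_self hv).2 (Or.inl rfl), fun x hx => ?_⟩
  rcases (mem_bulkPath_self hv).1 hx with rfl | ⟨η, hηW, hη, hηhub, hxη⟩
  · exact Or.inl rfl
  · exact Or.inr ⟨η, hη.symm, hxη,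
      fun y hy => (mem_bulkPath_self hv).2 (Or.inr ⟨η, hηW, hη, hηhub, hy⟩)⟩

theorem IsFan.union_reachSet (hF : IsFan G W v F) (huv : G.Adj u v) :
    IsFan G W v (F ∪ reachSet G (W \ {v}) u) := by
  refine ⟨Or.inl hF.1, ?_⟩
  rintro x (hx | hx)
  · exact (hF.2 x hx).imp id fun ⟨η, hη, hxη, hsub⟩ =>
      ⟨η, hη, hxη, hsub.trans subset_union_left⟩
  · exact Or.inr ⟨u, huv, hx, subset_union_right⟩

theorem IsFan.subset (hF : IsFan G W v F) (hv : v ∈ W) : F ⊆ W := by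
  intro x hx
  rcases hF.2 x hx with rfl | ⟨η, -, hxη, -⟩
  · exact hv
  · exact (reachSet_subset_s4 hxη).1

/-- A neighbour of a hub-tree node on the side of a sink is a hub-tree node. -/
theorem mem_hubVerts_of_sink (hG : G.IsTree) (hvhub : v ∈ hubVerts G W S r) (hη : η ∈ W)
    (hvη : G.Adj v η) (hs : s ∈ S) (hsη : s ∈ reachSet G (W \ {v}) η) :
    η ∈ hubVerts G W S r := by
  have key : ∀ a b, a ∈ W → (a ∈ reachSet G (W \ {v}) η ↔ b ∉ reachSet G (W \ {v}) η) →
      b ∉ reachSet G (W \ {η}) a := by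
    intro a b ha hab hb
    have hK := isSubtree_reachSet_s4 (G := G) (mem_of_mem_reachSet hb)
    have haK := mem_reachSet_self (G := G) (mem_of_mem_reachSet hb)
    have hKW : reachSet G (W \ {η}) a ⊆ W := fun z hz => (reachSet_subset_s4 hz).1
    refine notMem_reachSet_diff_singleton (G := G) (W := W) (v := η) (u := a) ?_
    by_cases haC : a ∈ reachSet G (W \ {v}) η
    · exact (hK.mem_of_crosses hG hvη.symm hKW haK haC hb (hab.1 haC)).1
    · exact (hK.mem_of_crosses hG hvη.symm hKW hb (not_not.1 fun h => haC (hab.2 h)) haK haC).1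
  obtain ⟨s₀, hs₀, hs₀W, hrW, hvW, hr⟩ := hvhub
  by_cases hrC : r ∈ reachSet G (W \ {v}) η
  · have hs₀C : s₀ ∉ reachSet G (W \ {v}) η := fun h =>
      hr (reachSet_trans (reachSet_symm h) hrC)
    exact ⟨s₀, hs₀, hs₀W, hrW, hη, key s₀ r hs₀W (by simp [hs₀C, hrC])⟩
  · exact ⟨s, hs, (reachSet_subset_s4 hsη).1, hrW, hη,
      key s r (reachSet_subset_s4 hsη).1 (by simp [hsη, hrC])⟩

theorem disjoint_bulkPath_reachSet (hG : G.IsTree) (huhub : u ∈ hubVerts G W S r) (hv : v ∈ W)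
    (huv : G.Adj u v) : Disjoint (bulkPath G W S r v v) (reachSet G (W \ {v}) u) := by
  rw [Set.disjoint_left]
  intro x hx hxR
  rcases (mem_bulkPath_self hv).1 hx with rfl | ⟨η, hηW, hη, hηhub, hxη⟩
  · exact notMem_reachSet_diff_singleton hxR
  · have hu := mem_of_mem_reachSet hxR
    have := (isSubtree_reachSet_s4 hu).eq_of_adj hG notMem_reachSet_diff_singleton
      (reachSet_trans hxR (reachSet_symm hxη)) (mem_reachSet_self hu) hη.symm huv
    exact hηhub (this ▸ huhub)

/-- Adding the outstanding branches at `v` to a block of a sink at `v` respects the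
threshold if the working tree is RC-viable. -/
theorem IsMinmaxMonotone.cost_union_bulkPath_le (hf : IsMinmaxMonotone G f)
    (hRC : RCViable G f 𝒯 W S r) (hv : v ∈ hubVerts G W S r) (hvW : v ∈ W)
    {A : Set V} (hA : IsSubtree G A) (hvA : v ∈ A) (hAW : A ⊆ W) (hfA : f A v ≤ 𝒯) :
    f (A ∪ bulkPath G W S r v v) v ≤ 𝒯 := by
  have hB := isFan_bulkPath (G := G) (S := S) (r := r) hvW
  have hsub : (A ∪ bulkPath G W S r v v) \ {v} ⊆ W \ {v} :=
    sdiff_subset_sdiff_left (union_subset hAW (hB.subset hvW))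
  refine hf.cost_le_of_forall (hA.union hB.isSubtree hvA hB.1) (Or.inl hvA) fun x hx hxv => ?_
  by_cases hxB : x ∈ bulkPath G W S r v v
  · obtain ⟨η, hηW, hη, hηhub, hxη⟩ := ((mem_bulkPath_self hvW).1 hxB).resolve_left hxv
    exact ⟨_, isSubtree_reachSet_union_singleton hη.symm hxη, Or.inr rfl,
      hRC v hv η hηW hη hηhub,
      fun y hy => Or.inl (reachSet_trans hxη (reachSet_mono hsub hy))⟩
  · refine ⟨A, hA, hvA, hfA, fun y hy => (reachSet_subset_s4 hy).1.resolve_right fun hyB => hxB ?_⟩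
    have hyv : y ≠ v := (reachSet_subset_s4 hy).2
    obtain ⟨η, hηW, hη, hηhub, hyη⟩ := ((mem_bulkPath_self hvW).1 hyB).resolve_left hyv
    exact (mem_bulkPath_self hvW).2 (Or.inr ⟨η, hηW, hη, hηhub,
      reachSet_trans hyη (reachSet_symm (reachSet_mono hsub hy))⟩)

/-- A node of the working tree on the path from a node `u` to a different node `r` is not
a leaf. -/
theorem not_isLeafOf_of_onPath (hG : G.IsTree) (hW : IsSubtree G W) (huv : G.Adj u v)
    (h : OnPath G W u r v) (hvr : v ≠ r) : ¬ IsLeafOf G W v := by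
  rintro ⟨-, w, -, huniq⟩
  obtain ⟨huW, hrW, hvW, hr⟩ := h
  have hu : u ∈ reachSet G (W \ {v}) u := mem_reachSet_self ⟨huW, huv.ne⟩
  obtain ⟨a, ha, b, hb, haX, hbX, hab⟩ := hW.exists_boundary
    (insert v (reachSet G (W \ {v}) u)) hvW (mem_insert _ _) hrW (by simp [hr, hvr.symm])
  rw [mem_insert_iff, not_or] at hbX
  rcases haX with rfl | haX
  · have : b = u := (huniq b ⟨hb, hab⟩).trans (huniq u ⟨huW, huv.symm⟩).symm
    exact hbX.2 (this ▸ hu)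
  · exact hbX.1 (eq_of_adj_reachSet hG huv haX hb hbX.2 hab).2

theorem IsLeafOf.diff_reachSet (hG : G.IsTree) (hs : IsLeafOf G W s) (huv : G.Adj u v)
    (hsR : s ∉ reachSet G (W \ {v}) u) (hsv : s ≠ v) :
    IsLeafOf G (W \ reachSet G (W \ {v}) u) s := by
  obtain ⟨hsW, w, ⟨hwW, hsw⟩, huniq⟩ := hs
  refine ⟨⟨hsW, hsR⟩, w, ⟨⟨hwW, fun hwR => ?_⟩, hsw⟩, fun y hy => huniq y ⟨hy.1.1, hy.2⟩⟩
  exact hsv (eq_of_adj_reachSet hG huv hwR hsW hsR hsw.symm).2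

end Fans

open Classical in
/-- Closed commits: absorbing blocks of a set `R` in the working tree into the blocks of the
sinks contained in `R`. -/
theorem IsPartialConfig.commit {G : SimpleGraph V} {f : Set V → V → ℝ≥0∞} {𝒯 : ℝ≥0∞}
    {W Sout R : Set V} {P P' : V → Set V} (hG : G.IsTree) (hf : IsMinmaxMonotone G f)
    (h : IsPartialConfig G f 𝒯 W Sout P) (hRW : R ⊆ W)
    (hunion : (⋃ s ∈ (Sout ∩ W) ∩ R, P' s) = R)
    (hblocks : ∀ s ∈ (Sout ∩ W) ∩ R, IsSubtree G (P' s) ∧ s ∈ P' s ∧ f (P' s) s ≤ 𝒯)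
    (hdisj : ((Sout ∩ W) ∩ R).Pairwise fun a b => Disjoint (P' a) (P' b)) :
    IsPartialConfig G f 𝒯 (W \ R) Sout
      (fun s => if s ∈ (Sout ∩ W) ∩ R then P s ∪ P' s else P s) := by
  have hsub : ∀ s ∈ (Sout ∩ W) ∩ R, P' s ⊆ R := fun s hs x hx =>
    hunion ▸ mem_biUnion hs hx
  have hcross : ∀ s ∈ Sout, ∀ t ∈ (Sout ∩ W) ∩ R, ∀ x ∈ P s, x ∈ P' t → x = s ∧ x = t := by
    intro s hs t ht x hxs hxt
    have hxR := hsub t ht hxt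
    obtain rfl := h.eq_of_mem hs hxs (hRW hxR)
    refine ⟨rfl, ?_⟩
    have hx : x ∈ (Sout ∩ W) ∩ R := ⟨⟨hs, hRW hxR⟩, hxR⟩
    by_contra hne
    exact (hdisj hx ht hne).le_bot ⟨(hblocks x hx).2.1, hxt⟩
  refine ⟨fun s hs t ht hst => ?_, fun s hs => ?_, ?_⟩
  · have hPP := h.1 hs ht hst
    have h1 : ∀ a ∈ Sout, ∀ b ∈ (Sout ∩ W) ∩ R, a ≠ b → Disjoint (P a) (P' b) := by
      intro a ha b hb hab
      rw [Set.disjoint_left]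
      intro x hxa hxb
      obtain ⟨e, e'⟩ := hcross a ha b hb x hxa hxb
      exact hab (e.symm.trans e')
    dsimp only
    split_ifs with hsR htR htR
    · rw [disjoint_union_left, disjoint_union_right, disjoint_union_right]
      exact ⟨⟨hPP, h1 s hs t htR hst⟩, (h1 t ht s hsR hst.symm).symm, hdisj hsR htR hst⟩
    · rw [disjoint_union_left]
      exact ⟨hPP, (h1 t ht s hsR hst.symm).symm⟩
    · rw [disjoint_union_right]
      exact ⟨hPP, h1 s hs t htR hst⟩
    · exact hPP
  · obtain ⟨hP, hsP, hfP⟩ := h.2.1 s hs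
    dsimp only
    split_ifs with hsR
    · obtain ⟨hP', hsP', hfP'⟩ := hblocks s hsR
      refine ⟨hP.union hP' hsP hsP', Or.inl hsP, hf.cost_union_le hG hP hP' ?_ hfP hfP'⟩
      exact Subset.antisymm (fun x hx => (hcross s hs s hsR x hx.1 hx.2).1)
        (singleton_subset_iff.2 ⟨hsP, hsP'⟩)
    · exact ⟨hP, hsP, hfP⟩
  · ext x
    have hx : (∃ s ∈ Sout, x ∈ P s) ↔ ¬ (x ∈ W ∧ x ∉ Sout) := by
      have := Set.ext_iff.1 h.2.2 x
      simpa using this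
    have hxR : (∃ s ∈ (Sout ∩ W) ∩ R, x ∈ P' s) ↔ x ∈ R := by
      have := Set.ext_iff.1 hunion x
      rwa [mem_iUnion₂, bex_def] at this
    rw [mem_iUnion₂, bex_def]
    constructor
    · rintro ⟨s, hs, hxs⟩
      refine ⟨trivial, fun hxW => ?_⟩
      have hold : x ∉ P s := fun hxP => hx.1 ⟨s, hs, hxP⟩ ⟨hxW.1.1, hxW.2⟩
      dsimp only at hxs
      split_ifs at hxs with hsR
      · exact hxW.1.2 (hsub s hsR (hxs.resolve_left hold))
      · exact hold hxs
    · rintro ⟨-, hxW⟩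
      by_cases hxR' : x ∈ R
      · obtain ⟨s, hs, hxs⟩ := hxR.2 hxR'
        exact ⟨s, hs.1.1, by
          dsimp only
          rw [if_pos hs]
          exact Or.inr hxs⟩
      · obtain ⟨s, hs, hxs⟩ := hx.2 fun h => hxW ⟨⟨h.1, hxR'⟩, h.2⟩
        refine ⟨s, hs, ?_⟩
        dsimp only
        split_ifs
        · exact Or.inl hxs
        · exact hxs

open Classical in
/-- Reaching Lemma: given a reaching pair `(u,v)` and a partition of
`V₋ᵥ(u)` witnessing the self-sufficiency of `T₋ᵥ(u)`, merging the witness blocks into the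
blocks of the corresponding sinks (closed commits) and removing `V₋ᵥ(u)` from the working
tree keeps the partial sink configuration optimal relative to the new working tree. -/
theorem statement_4 [Fintype V] (G : SimpleGraph V) (hG : G.IsTree)
    (f : Set V → V → ℝ≥0∞) (hf : IsMinmaxMonotone G f) (𝒯 : ℝ≥0∞)
    (W : Set V) (hW : IsSubtree G W)
    (Sout : Set V) (P : V → Set V)
    (hpart : IsPartialConfig G f 𝒯 W Sout P)
    (hopt : OptimalRelative G f 𝒯 W Sout P)
    (r : V) (hS2 : 2 ≤ (Sout ∩ W).ncard) (hW2 : 2 < W.ncard)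
    (hroot : GoodRoot G W (Sout ∩ W) r)
    (hRC : RCViable G f 𝒯 W (Sout ∩ W) r)
    (u v : V) (hreach : ReachingPair G f 𝒯 W (Sout ∩ W) r u v)
    (P' : V → Set V)
    (hP'union : (⋃ s ∈ (Sout ∩ W) ∩ reachSet G (W \ {v}) u, P' s) = reachSet G (W \ {v}) u)
    (hP'blocks : ∀ s ∈ (Sout ∩ W) ∩ reachSet G (W \ {v}) u,
      IsSubtree G (P' s) ∧ s ∈ P' s ∧ f (P' s) s ≤ 𝒯)
    (hP'disj : ((Sout ∩ W) ∩ reachSet G (W \ {v}) u).Pairwise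
      fun a b => Disjoint (P' a) (P' b)) :
    IsPartialConfig G f 𝒯 (W \ reachSet G (W \ {v}) u) Sout
      (fun s => if s ∈ (Sout ∩ W) ∩ reachSet G (W \ {v}) u then P s ∪ P' s else P s) ∧
    OptimalRelative G f 𝒯 (W \ reachSet G (W \ {v}) u) Sout
      (fun s => if s ∈ (Sout ∩ W) ∩ reachSet G (W \ {v}) u then P s ∪ P' s else P s) := by
  set R := reachSet G (W \ {v}) u
  obtain ⟨⟨huhub, hvhub, huv, hpath⟩, -, hnot⟩ := hreach
  obtain ⟨huW, hrW, hvW, hr⟩ := id hpath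
  have hRW : R ⊆ W := fun x hx => (reachSet_subset_s4 hx).1
  have hvR : v ∉ R := notMem_reachSet_diff_singleton
  have hpart' := hpart.commit hG hf hRW hP'union hP'blocks hP'disj
  refine ⟨hpart', ?_⟩
  obtain ⟨St, Pt, ⟨⟨hPcover, hPdisj, hPt⟩, hmin⟩, hSoutSt, hStW, hleaf, hPtW, hPold, hPnew⟩ :=
    hopt
  have hvS : v ∉ Sout := fun hv => not_isLeafOf_of_onPath hG hW huv hpath
    (fun e => hroot.2.1 ⟨e ▸ hv, hrW⟩) (hleaf v ⟨hv, hvW⟩)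
  have hleaf' : ∀ s ∈ Sout ∩ (W \ R), IsLeafOf G (W \ R) s := fun s hs =>
    (hleaf s ⟨hs.1, hs.2.1⟩).diff_reachSet hG huv hs.2.2 fun e => hvS (e ▸ hs.1)
  have hSt : ∀ s ∈ St, s ∉ W → s ∈ Sout := fun s hs hsW => (hStW.le ⟨hs, hsW⟩).1
  have hmem : ∀ s ∈ St, s ∈ Pt s := fun s hs => ((hPt s hs).2.1.ge rfl).2
  have hown : ∀ x, ∃ s ∈ St, x ∈ Pt s := fun x => by
    have hx : x ∈ ⋃ s ∈ St, Pt s := hPcover ▸ mem_univ x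
    simpa only [mem_iUnion₂, bex_def] using hx
  have hownW : ∀ s ∈ St, ∀ x ∈ W, x ∈ Pt s → s ∈ W := fun s hs x hxW hx => by
    by_contra hsW
    exact (hPtW s hs hsW).2.le ⟨hx, hxW⟩
  have huniq : ∀ s ∈ St, ∀ t ∈ St, ∀ x, x ∈ Pt s → x ∈ Pt t → s = t := by
    intro s hs t ht x hxs hxt
    by_contra hne
    exact (hPdisj hs ht hne).le_bot ⟨hxs, hxt⟩
  have hcross : ∀ F, IsFan G W v F → ∀ s ∈ St, ∀ x ∈ W, x ∈ Pt s → (s ∈ F ↔ x ∉ F) →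
      v ∈ Pt s := by
    intro F hF s hs x hxW hx hiff
    have hsW := hownW s hs x hxW hx
    have hK := (hPt s hs).1.inter hG hW (hmem s hs) hsW
    by_cases hsF : s ∈ F
    · exact (hF.mem_of_crosses hG hK inter_subset_right ⟨hmem s hs, hsW⟩ hsF ⟨hx, hxW⟩
        (hiff.1 hsF)).1
    · exact (hF.mem_of_crosses hG hK inter_subset_right ⟨hx, hxW⟩
        (not_not.1 fun h => hsF (hiff.2 h)) ⟨hmem s hs, hsW⟩ hsF).1
  have hmerged : ∀ s ∈ Sout ∩ (W \ R),
      (if s ∈ (Sout ∩ W) ∩ R then P s ∪ P' s else P s) = P s :=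
    fun s hs => if_neg fun h => hs.2.2 h.2
  have hPR : ∀ s ∈ Sout ∩ (W \ R), Disjoint (P s) R := by
    intro s hs
    rw [Set.disjoint_left]
    intro x hx hxR
    exact hs.2.2 (hpart.eq_of_mem hs.1 hx (hRW hxR) ▸ hxR)
  obtain ⟨t, ht, hvt⟩ := hown v
  have htW : t ∈ W := hownW t ht v hvW hvt
  have hW' : IsSubtree G (W \ R) := hW.diff_reachSet hG hvW huv
  by_cases htR : t ∈ R
  · set B := bulkPath G W (Sout ∩ W) r v v
    have hB : IsFan G W v B := isFan_bulkPath hvW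
    have hBR : IsFan G W v (B ∪ R) := hB.union_reachSet huv
    have hBRdisj : Disjoint B R := disjoint_bulkPath_reachSet hG huhub hvW huv
    have hBW : B ⊆ W \ R := fun x hx => ⟨hB.subset hvW hx, hBRdisj.notMem_of_mem_left hx⟩
    have hBS : ∀ s ∈ B, s ∉ Sout := by
      intro s hs hsS
      rcases (mem_bulkPath_self hvW).1 hs with rfl | ⟨η, hηW, hη, hηhub, hsη⟩
      · exact hvS hsS
      · exact hηhub (mem_hubVerts_of_sink hG hvhub hηW hη ⟨hsS, hB.subset hvW hs⟩ hsη)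
    obtain ⟨z, hz, hzBR, hzS⟩ : ∃ z ∈ St, z ∈ B ∪ R ∧ z ∉ Sout := by
      by_contra! hall
      have hin : ∀ s ∈ (Sout ∩ W) ∩ (B ∪ R), IsSubtree G (Pt s ∩ (B ∪ R)) := fun s hs =>
        (hPt s (hSoutSt hs.1.1)).1.inter hG hBR.isSubtree (hmem s (hSoutSt hs.1.1)) hs.2
      refine hnot ⟨fun s => Pt s ∩ (B ∪ R), ?_, fun s hs => ?_, fun s hs s' hs' hne => ?_⟩
      · refine Subset.antisymm (iUnion₂_subset fun s _ => inter_subset_right) fun x hx => ?_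
        obtain ⟨s, hs, hxs⟩ := hown x
        have hxW := hBR.subset hvW hx
        have hsBR : s ∈ B ∪ R := by
          by_contra hsBR
          have hvs := hcross _ hBR s hs x hxW hxs (iff_of_false hsBR (not_not.2 hx))
          exact hsBR (huniq t ht s hs v hvt hvs ▸ Or.inr htR)
        exact mem_biUnion (x := s) ⟨⟨hall s hs hsBR, hownW s hs x hxW hxs⟩, hsBR⟩ ⟨hxs, hx⟩
      · have hsSt := hSoutSt hs.1.1
        exact ⟨hin s hs, ⟨hmem s hsSt, hs.2⟩,
          (hf.set_mono _ _ s (hin s hs) (hPt s hsSt).1 ⟨hmem s hsSt, hs.2⟩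
            inter_subset_left).trans (hPt s hsSt).2.2⟩
      · exact (hPdisj (hSoutSt hs.1.1) (hSoutSt hs'.1.1) hne).mono inter_subset_left
          inter_subset_left
    have hA : IsSubtree G (Pt t ∩ (W \ R)) :=
      (hPt t ht).1.inter hG hW' hvt ⟨hvW, hvR⟩
    have hAcost : f (Pt t ∩ (W \ R)) v ≤ 𝒯 := by
      have hU : IsSubtree G (Pt t ∩ W) := (hPt t ht).1.inter hG hW hvt hvW
      refine (hf.cost_le_of_attached hU hA (inter_subset_inter_right _ sdiff_subset)
        ⟨hvt, hvW, hvR⟩ ⟨hmem t ht, htW⟩ (fun h => absurd htR h.2.2) ?_).trans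
        ((hf.set_mono _ _ t hU (hPt t ht).1 ⟨hmem t ht, htW⟩ inter_subset_left).trans
          (hPt t ht).2.2)
      intro x hx y hy hyA hxy
      have hyR : y ∈ R := by
        by_contra hyR
        exact hyA ⟨hy.1, hy.2, hyR⟩
      exact (eq_of_adj_reachSet hG huv hyR hx.2.1 hx.2.2 hxy.symm).2
    set St' := insert v (St \ ((B ∪ R) \ Sout))
    have hold : ∀ s ∈ St' ∩ (W \ R), s ≠ v → s ∈ St ∧ s ∉ B ∪ R := by
      rintro s ⟨hs, hsW, hsR⟩ hsv
      have hs' := hs.resolve_left hsv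
      refine ⟨hs'.1, fun h => hs'.2 ⟨h, fun hsS => ?_⟩⟩
      exact h.elim (fun hsB => hBS s hsB hsS) hsR
    have hmiss : ∀ s ∈ St' ∩ (W \ R), s ≠ v → Disjoint (Pt s) (B ∪ R) := by
      intro s hs hsv
      obtain ⟨hsSt, hsBR⟩ := hold s hs hsv
      rw [Set.disjoint_left]
      intro x hx hxBR
      have hvs := hcross _ hBR s hsSt x (hBR.subset hvW hxBR) hx
        (by simp only [hsBR, hxBR, not_true])
      exact hs.2.2 (huniq t ht s hsSt v hvt hvs ▸ htR)
    have hvdisj : ∀ s ∈ St' ∩ (W \ R), s ≠ v → Disjoint (Pt s) (Pt t ∩ (W \ R) ∪ B) := by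
      intro s hs hsv
      rw [disjoint_union_right]
      exact ⟨(hPdisj (hold s hs hsv).1 ht fun e => hs.2.2 (e ▸ htR)).mono_right inter_subset_left,
        (hmiss s hs hsv).mono_right subset_union_left⟩
    refine hpart'.optimalRelative hleaf' (St := St')
      (Q := fun s => if s = v then Pt t ∩ (W \ R) ∪ B else Pt s) ?_ ?_ ?_ ?_ ?_ ?_ ?_ ?_
    · exact fun s hs => Or.inr ⟨hSoutSt hs, fun h => h.2 hs⟩
    · rintro s (rfl | hs) hsW
      · exact absurd ⟨hvW, hvR⟩ hsW
      · by_contra hsS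
        have hsW' : s ∈ W := not_not.1 fun h => hsS (hSt s hs.1 h)
        have hsR : s ∈ R := not_not.1 fun h => hsW ⟨hsW', h⟩
        exact hs.2 ⟨Or.inr hsR, hsS⟩
    · intro s hs
      split_ifs with hsv
      · subst hsv
        exact ⟨hA.union hB.isSubtree ⟨hvt, hvW, hvR⟩ hB.1, Or.inr hB.1,
          hf.cost_union_bulkPath_le hRC hvhub hvW hA ⟨hvt, hvW, hvR⟩
            (inter_subset_right.trans sdiff_subset) hAcost⟩
      · have hsSt := (hold s hs hsv).1
        exact ⟨(hPt s hsSt).1, hmem s hsSt, (hPt s hsSt).2.2⟩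
    · intro s hs
      have hsv : s ≠ v := fun e => hvS (e ▸ hs.1)
      rw [hmerged s hs, if_neg hsv]
      have hPs := hPold s ⟨hs.1, hs.2.1⟩
      have hs' : s ∈ St' ∩ (W \ R) := ⟨Or.inr ⟨hSoutSt hs.1, fun h => h.2 hs.1⟩, hs.2⟩
      exact ⟨hPs.1, fun x hx =>
        ⟨hPs.2 hx, fun hxR => (hmiss s hs' hsv).le_bot ⟨hx.1, Or.inr hxR⟩⟩⟩
    · intro s hs hsS
      split_ifs with hsv
      · exact union_subset inter_subset_right hBW
      · exact fun x hx => ⟨hPnew s (hold s hs hsv).1 hsS hx,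
          fun hxR => (hmiss s hs hsv).le_bot ⟨hx, Or.inr hxR⟩⟩
    · intro s hs s' hs' hne
      split_ifs with hsv hsv' hsv'
      · exact absurd (hsv.trans hsv'.symm) hne
      · exact (hvdisj s' hs' hsv').symm
      · exact hvdisj s hs hsv
      · exact hPdisj (hold s hs hsv).1 (hold s' hs' hsv').1 hne
    · intro x hx
      obtain ⟨s, hs, hxs⟩ := hown x
      by_cases hxv : x ∈ Pt t ∩ (W \ R) ∪ B
      · exact ⟨v, ⟨Or.inl rfl, hvW, hvR⟩, by simpa only [if_true] using hxv⟩
      · have hst : s ≠ t := fun e => hxv (Or.inl ⟨e ▸ hxs, hx⟩)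
        have hxBR : x ∉ B ∪ R := fun h => h.elim (fun h => hxv (Or.inr h)) hx.2
        have hsBR : s ∉ B ∪ R := fun hsBR => hst
          (huniq s hs t ht v
            (hcross _ hBR s hs x hx.1 hxs (by simp only [hsBR, hxBR, not_false_iff])) hvt)
        have hsv : s ≠ v := fun e => hsBR (e ▸ hBR.1)
        refine ⟨s, ⟨Or.inr ⟨hs, fun h => hsBR h.1⟩, hownW s hs x hx.1 hxs,
          fun h => hsBR (Or.inr h)⟩, ?_⟩
        rwa [if_neg hsv]
    · intro St'' P'' h''
      refine le_trans ?_ (hmin St'' P'' h'')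
      have hsub : St \ ((B ∪ R) \ Sout) ⊆ St \ {z} :=
        sdiff_subset_sdiff_right (singleton_subset_iff.2 ⟨hzBR, hzS⟩)
      calc St'.ncard ≤ (St \ ((B ∪ R) \ Sout)).ncard + 1 := ncard_insert_le _ _
        _ ≤ (St \ {z}).ncard + 1 := Nat.add_le_add_right (ncard_le_ncard hsub) 1
        _ = St.ncard := ncard_sdiff_singleton_add_one hz
  · have hfanR : IsFan G W v ({v} ∪ R) :=
      IsFan.union_reachSet (F := {v}) ⟨rfl, fun x hx => Or.inl hx⟩ huv
    have hQ : ∀ s ∈ St ∩ (W \ R), IsSubtree G (Pt s \ R) := by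
      rintro s ⟨hs, hsW, hsR⟩
      have hI := (hPt s hs).1.inter hG hW' (hmem s hs) ⟨hsW, hsR⟩
      by_cases hsS : s ∈ Sout
      · have hPs := hPold s ⟨hsS, hsW⟩
        have heq : Pt s \ R = Pt s ∩ (W \ R) ∪ P s := by
          ext x
          constructor
          · rintro ⟨hx, hxR⟩
            by_cases hxP : x ∈ P s
            · exact Or.inr hxP
            · exact Or.inl ⟨hx, hPs.2 ⟨hx, hxP⟩, hxR⟩
          · rintro (hx | hx)
            · exact ⟨hx.1, hx.2.2⟩
            · exact ⟨hPs.1 hx, (hPR s ⟨hsS, hsW, hsR⟩).notMem_of_mem_left hx⟩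
        obtain ⟨hP, hsP, -⟩ := hpart.2.1 s hsS
        exact heq ▸ hI.union hP ⟨hmem s hs, hsW, hsR⟩ hsP
      · have heq : Pt s \ R = Pt s ∩ (W \ R) := by
          ext x
          exact ⟨fun hx => ⟨hx.1, hPnew s hs hsS hx.1, hx.2⟩, fun hx => ⟨hx.1, hx.2.2⟩⟩
        exact heq ▸ hI
    refine hpart'.optimalRelative hleaf' (St := St \ (R \ Sout)) (Q := fun s => Pt s \ R)
      ?_ ?_ ?_ ?_ ?_ ?_ ?_ ?_
    · exact fun s hs => ⟨hSoutSt hs, fun h => h.2 hs⟩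
    · rintro s hs hsW
      by_contra hsS
      have hsW' : s ∈ W := not_not.1 fun h => hsS (hSt s hs.1 h)
      exact hs.2 ⟨not_not.1 fun h => hsW ⟨hsW', h⟩, hsS⟩
    · intro s hs
      have hs' : s ∈ St ∩ (W \ R) := ⟨hs.1.1, hs.2⟩
      have hsR : s ∈ Pt s \ R := ⟨hmem s hs.1.1, hs.2.2⟩
      exact ⟨hQ s hs', hsR, (hf.set_mono _ _ s (hQ s hs') (hPt s hs.1.1).1 hsR
        sdiff_subset).trans (hPt s hs.1.1).2.2⟩
    · intro s hs
      rw [hmerged s hs]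
      have hPs := hPold s ⟨hs.1, hs.2.1⟩
      exact ⟨fun x hx => ⟨hPs.1 hx, (hPR s hs).notMem_of_mem_left hx⟩,
        fun x hx => ⟨hPs.2 ⟨hx.1.1, hx.2⟩, hx.1.2⟩⟩
    · exact fun s hs hsS x hx => ⟨hPnew s hs.1.1 hsS hx.1, hx.2⟩
    · exact fun s hs s' hs' hne =>
        (hPdisj hs.1.1 hs'.1.1 hne).mono sdiff_subset sdiff_subset
    · intro x hx
      obtain ⟨s, hs, hxs⟩ := hown x
      have hsR : s ∉ R := by
        intro hsR
        have hvs : v ∈ Pt s := by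
          by_cases hxv : x = v
          · exact hxv ▸ hxs
          · exact hcross _ hfanR s hs x hx.1 hxs (by simp [hsR, hxv, hx.2])
        exact htR (huniq s hs t ht v hvs hvt ▸ hsR)
      exact ⟨s, ⟨⟨hs, fun h => hsR h.1⟩, hownW s hs x hx.1 hxs, hsR⟩, hxs, hx.2⟩
    · exact fun St'' P'' h'' => (ncard_le_ncard sdiff_subset).trans (hmin St'' P'' h'')
end
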